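/- If φ is a non-growing morphism prolongable on a, the pure morphic sequence α = φ^∞(a) is not ultimately periodic, and the factors of α consisting only of bounded letters have unbounded length, then P_α(n) = Θ(n²). -/

import Mathlib

open Filter Asymptotics

variable {A : Type*}

/-- Extension of a morphism, given on letters, to words. -/
def wordMap (φ : A → List A) (w : List A) : List A := w.flatMap φ

/-- The factor of the infinite word α of length n starting at position i. -/
def factorAt (α : ℕ → A) (i n : ℕ) : List A := (List.range n).map (fun j => α (i + j))

/-- w is a factor (contiguous subword) of the infinite word α. -/
def IsFactor (α : ℕ → A) (w : List A) : Prop := ∃ i, w = factorAt α i w.length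

/-- The factor complexity of α: the number of distinct factors of length n. -/
noncomputable def complexity (α : ℕ → A) (n : ℕ) : ℕ :=
  Set.ncard {w : List A | w.length = n ∧ IsFactor α w}

def UltimatelyPeriodic (α : ℕ → A) : Prop :=
  ∃ N p : ℕ, 1 ≤ p ∧ ∀ i, N ≤ i → α (i + p) = α i

/-- φ is prolongable on a: φ(a) = a·w with w nonempty and |φ^n(a)| → ∞. -/
def Prolongable (φ : A → List A) (a : A) : Prop :=
  (∃ w, w ≠ [] ∧ φ a = a :: w) ∧
    Tendsto (fun n => ((wordMap φ)^[n] [a]).length) atTop atTop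

/-- α is the pure morphic sequence φ^∞(a): every iterate φ^n(a) is a prefix of α. -/
def IsFixedSeq (φ : A → List A) (a : A) (α : ℕ → A) : Prop :=
  ∀ n, factorAt α 0 ((wordMap φ)^[n] [a]).length = (wordMap φ)^[n] [a]

/-- The letter b is growing for φ: |φ^k(b)| → ∞. -/
def GrowingLetter (φ : A → List A) (b : A) : Prop :=
  Tendsto (fun k => ((wordMap φ)^[k] [b]).length) atTop atTop

def BoundedLetter (φ : A → List A) (b : A) : Prop := ¬ GrowingLetter φ b

/-- φ is growing: every letter is growing. -/
def Growing (φ : A → List A) : Prop := ∀ b, GrowingLetter φ b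

/-- The factors of α consisting only of bounded letters have bounded length. -/
def BFactorsBounded (φ : A → List A) (α : ℕ → A) : Prop :=
  ∃ C, ∀ w : List A, IsFactor α w → (∀ b ∈ w, BoundedLetter φ b) → w.length ≤ C

/-! ### Iterated images of words -/

@[simp] lemma wordMap_nil (φ : A → List A) : wordMap φ [] = [] := rfl

@[simp] lemma wordMap_append (φ : A → List A) (u v : List A) :
    wordMap φ (u ++ v) = wordMap φ u ++ wordMap φ v := by
  simp [wordMap]

@[simp] lemma wordMap_cons (φ : A → List A) (b : A) (v : List A) :
    wordMap φ (b :: v) = φ b ++ wordMap φ v := by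
  simp [wordMap]

@[simp] lemma iterate_wordMap_nil (φ : A → List A) (k : ℕ) : (wordMap φ)^[k] [] = [] :=
  Function.iterate_fixed (wordMap_nil φ) k

@[simp] lemma iterate_wordMap_append (φ : A → List A) (k : ℕ) (u v : List A) :
    (wordMap φ)^[k] (u ++ v) = (wordMap φ)^[k] u ++ (wordMap φ)^[k] v := by
  induction k generalizing u v with
  | zero => rfl
  | succ k ih => simp [Function.iterate_succ_apply, ih]

lemma iterate_wordMap_cons (φ : A → List A) (k : ℕ) (b : A) (v : List A) :
    (wordMap φ)^[k] (b :: v) = (wordMap φ)^[k] [b] ++ (wordMap φ)^[k] v := by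
  rw [← iterate_wordMap_append]; rfl

lemma iterate_succ_wordMap_singleton (φ : A → List A) (k : ℕ) (b : A) :
    (wordMap φ)^[k + 1] [b] = (wordMap φ)^[k] (φ b) := by
  simp [Function.iterate_succ_apply]

lemma length_iterate_singleton_le (φ : A → List A) (k : ℕ) {b : A} {w : List A} (hb : b ∈ w) :
    ((wordMap φ)^[k] [b]).length ≤ ((wordMap φ)^[k] w).length := by
  obtain ⟨u, v, rfl⟩ := List.append_of_mem hb
  rw [iterate_wordMap_append, iterate_wordMap_cons φ k b v]
  simp only [List.length_append]
  omega

/-- A letter that occurs together with further letters in its own image, and grows, grows at least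
linearly. -/
lemma length_iterate_of_self {φ : A → List A} {b : A} {t r : List A} (hb : φ b = t ++ b :: r)
    (hunb : ∀ C, ∃ k, C ≤ ((wordMap φ)^[k] [b]).length) (k : ℕ) :
    k + 1 ≤ ((wordMap φ)^[k] [b]).length := by
  have hstep : ∀ k, ((wordMap φ)^[k + 1] [b]).length
      = ((wordMap φ)^[k] [b]).length + ((wordMap φ)^[k] (t ++ r)).length := by
    intro k
    rw [iterate_succ_wordMap_singleton, hb, iterate_wordMap_append, iterate_wordMap_cons]
    simp only [iterate_wordMap_append, List.length_append]
    omega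
  have hne : ∀ k, (wordMap φ)^[k] (t ++ r) ≠ [] := by
    intro k hk
    have hk' : ∀ j, (wordMap φ)^[k + j] (t ++ r) = [] := by
      intro j
      rw [add_comm, Function.iterate_add_apply, hk, iterate_wordMap_nil]
    have hmono : Monotone fun k => ((wordMap φ)^[k] [b]).length :=
      monotone_nat_of_le_succ fun k => by simp only [hstep k]; omega
    have hconst : ∀ j, ((wordMap φ)^[k + j] [b]).length = ((wordMap φ)^[k] [b]).length := by
      intro j
      induction j with
      | zero => rfl
      | succ j ih => rw [← add_assoc, hstep, ih, hk']; rfl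
    obtain ⟨m, hm⟩ := hunb (((wordMap φ)^[k] [b]).length + 1)
    have h1 := hmono (Nat.le_add_left m k)
    simp only [hconst] at h1
    omega
  induction k with
  | zero => simp
  | succ k ih =>
    have := List.length_pos_of_ne_nil (hne k)
    rw [hstep]; omega

lemma exists_first_not {B : A → Prop} (w : List A) :
    (∀ x ∈ w, B x) ∨ ∃ t b r, w = t ++ b :: r ∧ (∀ x ∈ t, B x) ∧ ¬ B b := by
  induction w with
  | nil => simp
  | cons c w ih =>
    by_cases hc : B c
    · rcases ih with ih | ⟨t, b, r, rfl, ht, hb⟩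
      · left; simpa [hc] using ih
      · exact Or.inr ⟨c :: t, b, r, rfl, by simpa [hc] using ht, hb⟩
    · exact Or.inr ⟨[], c, w, rfl, by simp, hc⟩

lemma take_append_append_congr {m n : ℕ} {T x y r s : List A} (h : x.take m = y.take m)
    (hm : n ≤ T.length + m) (hx : m ≤ x.length) (hy : m ≤ y.length) :
    (T ++ (x ++ r)).take n = (T ++ (y ++ s)).take n := by
  rw [List.take_append, List.take_append (l₁ := T)]
  congr 1
  rw [List.take_append_of_le_length (by omega), List.take_append_of_le_length (by omega)]
  have := congrArg (List.take (n - T.length)) h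
  rwa [List.take_take, List.take_take, min_eq_left (by omega)] at this

/-- The mirror image of a morphism. -/
def mirror (φ : A → List A) (b : A) : List A := (φ b).reverse

@[simp] lemma mirror_mirror (φ : A → List A) : mirror (mirror φ) = φ := by
  funext b; simp [mirror]

lemma wordMap_mirror (φ : A → List A) (w : List A) :
    wordMap (mirror φ) w = (wordMap φ w.reverse).reverse := by
  induction w with
  | nil => rfl
  | cons b w ih => simp [ih, mirror]

lemma iterate_wordMap_mirror (φ : A → List A) (k : ℕ) (w : List A) :
    (wordMap (mirror φ))^[k] w = ((wordMap φ)^[k] w.reverse).reverse := by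
  induction k generalizing w with
  | zero => simp
  | succ k ih => simp [Function.iterate_succ_apply, ih, wordMap_mirror]

/-- The morphism whose value on letters is the `p`-th iterate of `φ`. -/
def morphismPow (φ : A → List A) (p : ℕ) (b : A) : List A := (wordMap φ)^[p] [b]

lemma wordMap_morphismPow (φ : A → List A) (p : ℕ) :
    wordMap (morphismPow φ p) = (wordMap φ)^[p] := by
  funext w
  induction w with
  | nil => simp
  | cons b w ih => rw [wordMap_cons, ih, iterate_wordMap_cons, morphismPow]

lemma iterate_wordMap_morphismPow (φ : A → List A) (p k : ℕ) :
    (wordMap (morphismPow φ p))^[k] = (wordMap φ)^[p * k] := by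
  rw [wordMap_morphismPow, Function.iterate_mul]

lemma mirror_morphismPow (φ : A → List A) (p : ℕ) :
    mirror (morphismPow φ p) = morphismPow (mirror φ) p := by
  funext b
  simp [mirror, morphismPow, iterate_wordMap_mirror]

/-! ### Morphisms in normal form -/

/-- The first letter of `φ b` outside `B` is `c`. -/
def Lead (φ : A → List A) (B : A → Prop) (b c : A) : Prop :=
  ∃ t r, φ b = t ++ c :: r ∧ (∀ x ∈ t, B x) ∧ ¬ B c

/-- `B` is a set of letters on which `φ` is idempotent, every letter outside `B` grows, and the maps
sending such a letter to the first and to the last letter outside `B` of its image are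
idempotent. -/
structure NormalForm (φ : A → List A) (B : A → Prop) : Prop where
  closed : ∀ b, B b → ∀ x ∈ φ b, B x
  idem : ∀ b, B b → wordMap φ (φ b) = φ b
  lead : ∀ b, ¬ B b → ∃ b', Lead φ B b b' ∧ Lead φ B b' b'
  trail : ∀ b, ¬ B b → ∃ b', Lead (mirror φ) B b b' ∧ Lead (mirror φ) B b' b'
  unbounded : ∀ b, ¬ B b → ∀ C, ∃ k, C ≤ ((wordMap φ)^[k] [b]).length

lemma lead_mirror {φ : A → List A} {B : A → Prop} {b b' : A} (h : Lead (mirror φ) B b b') :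
    ∃ r s, φ b = r ++ b' :: s ∧ (∀ x ∈ s, B x) ∧ ¬ B b' := by
  obtain ⟨t, r, h, ht, hb⟩ := h
  refine ⟨r.reverse, t.reverse, ?_, by simpa using ht, hb⟩
  rw [mirror, List.reverse_eq_iff] at h
  simpa using h

namespace NormalForm

variable {φ : A → List A} {B : A → Prop}

lemma mirror (h : NormalForm φ B) : NormalForm (mirror φ) B where
  closed b hb x hx := h.closed b hb x (by simpa [_root_.mirror] using hx)
  idem b hb := by simp [wordMap_mirror, _root_.mirror, h.idem b hb]
  lead := h.trail
  trail := by simpa using h.lead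
  unbounded b hb C := by simpa [iterate_wordMap_mirror] using h.unbounded b hb C

lemma closed_wordMap (h : NormalForm φ B) {w : List A} (hw : ∀ x ∈ w, B x) :
    ∀ x ∈ wordMap φ w, B x := by
  intro x hx
  simp only [wordMap, List.mem_flatMap] at hx
  obtain ⟨b, hb, hx⟩ := hx
  exact h.closed b (hw b hb) x hx

lemma idem_wordMap (h : NormalForm φ B) {w : List A} (hw : ∀ x ∈ w, B x) :
    wordMap φ (wordMap φ w) = wordMap φ w := by
  induction w with
  | nil => rfl
  | cons b w ih =>
    simp only [List.mem_cons, forall_eq_or_imp] at hw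
    simp [ih hw.2, h.idem b hw.1]

lemma iterate_succ (h : NormalForm φ B) {w : List A} (hw : ∀ x ∈ w, B x) (k : ℕ) :
    (wordMap φ)^[k + 1] w = wordMap φ w := by
  induction k with
  | zero => rfl
  | succ k ih => rw [Function.iterate_succ_apply', ih, h.idem_wordMap hw]

lemma length_iterate (h : NormalForm φ B) {b : A} (hb : ¬ B b) (k : ℕ) :
    k ≤ ((wordMap φ)^[k] [b]).length := by
  obtain ⟨b', ⟨t, r, ht, -, hb'⟩, t', r', ht', -, -⟩ := h.lead b hb
  cases k with
  | zero => simp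
  | succ k =>
    rw [iterate_succ_wordMap_singleton]
    refine (length_iterate_of_self ht' (h.unbounded b' hb') k).trans ?_
    exact length_iterate_singleton_le φ k (by simp [ht])

/-! ### Stabilization of prefixes -/

lemma take_stable_of_self (h : NormalForm φ B) {b : A} (hb : Lead φ B b b) (n k : ℕ)
    (hk : 2 * (n + 1) ≤ k) : ((wordMap φ)^[k + 1] [b]).take n = ((wordMap φ)^[k] [b]).take n := by
  obtain ⟨t, r, ht, htB, hbB⟩ := hb
  have hstep : ∀ k, 1 ≤ k → (wordMap φ)^[k + 1] [b]
      = wordMap φ t ++ ((wordMap φ)^[k] [b] ++ (wordMap φ)^[k] r) := by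
    intro k hk
    obtain ⟨k, rfl⟩ := Nat.exists_eq_add_of_le' hk
    rw [iterate_succ_wordMap_singleton, ht, iterate_wordMap_append, iterate_wordMap_cons,
      h.iterate_succ htB]
  rcases List.eq_nil_or_concat (wordMap φ t) with hT | ⟨T, c, hT⟩
  · rw [hstep k (by omega), hT, List.nil_append,
      List.take_append_of_le_length ((show n ≤ k by omega).trans (h.length_iterate hbB k))]
  · have hpos : 1 ≤ (wordMap φ t).length := by simp [hT]
    have key : ∀ m ≤ n, ∀ k, n + 1 + m ≤ k →
        ((wordMap φ)^[k + 1] [b]).take m = ((wordMap φ)^[k] [b]).take m := by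
      intro m
      induction m with
      | zero => simp
      | succ m ih =>
        intro hm k hk
        obtain ⟨k, rfl⟩ := Nat.exists_eq_add_of_le' (show 1 ≤ k by omega)
        have hl := h.length_iterate hbB (k + 1)
        have hl' := h.length_iterate hbB k
        rw [hstep (k + 1) (by omega)]
        conv_rhs => rw [hstep k (by omega)]
        exact take_append_append_congr (m := m) (ih (by omega) k (by omega)) (by omega) (by omega)
          (by omega)
    exact key n le_rfl k (by omega)

lemma take_stable_of_lead (h : NormalForm φ B) {w t r : List A} {b : A} (hw : w = t ++ b :: r)
    (ht : ∀ x ∈ t, B x) (hb : Lead φ B b b) (n k : ℕ) (hk : 2 * (n + 1) ≤ k) :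
    ((wordMap φ)^[k + 1] w).take n = ((wordMap φ)^[k] w).take n := by
  obtain ⟨k, rfl⟩ := Nat.exists_eq_add_of_le' (show 1 ≤ k by omega)
  have hbB : ¬ B b := by obtain ⟨_, _, _, _, h⟩ := hb; exact h
  rw [hw, iterate_wordMap_append, iterate_wordMap_append, h.iterate_succ ht, h.iterate_succ ht,
    iterate_wordMap_cons φ (k + 1 + 1), iterate_wordMap_cons φ (k + 1)]
  have hl := h.length_iterate hbB (k + 1)
  have hl' := h.length_iterate hbB (k + 1 + 1)
  exact take_append_append_congr (h.take_stable_of_self hb n (k + 1) hk) (by omega) (by omega)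
    (by omega)

/-- Prefixes of length `n` of the iterated images of a word are constant after linearly many
steps. -/
lemma take_stable (h : NormalForm φ B) (w : List A) (n k : ℕ) (hk : 2 * (n + 1) ≤ k) :
    ((wordMap φ)^[k + 2] w).take n = ((wordMap φ)^[k + 1] w).take n := by
  rcases exists_first_not (B := B) w with hw | ⟨t, b, r, rfl, ht, hb⟩
  · rw [h.iterate_succ hw, h.iterate_succ hw]
  · obtain ⟨b', ⟨t', r', hb', ht', -⟩, hself⟩ := h.lead b hb
    rw [Function.iterate_succ_apply, Function.iterate_succ_apply _ k]
    refine h.take_stable_of_lead (t := wordMap φ t ++ t') (r := r' ++ wordMap φ r) ?_ ?_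
      hself n k hk
    · simp [hb']
    · intro x hx
      rcases List.mem_append.1 hx with hx | hx
      · exact h.closed_wordMap ht x hx
      · exact ht' x hx

lemma take_eq_take_min (h : NormalForm φ B) (w : List A) {m n : ℕ} (hm : m ≤ n) (k : ℕ) :
    ((wordMap φ)^[k] w).take m = ((wordMap φ)^[min k (2 * n + 3)] w).take m := by
  rcases le_total k (2 * n + 3) with hk | hk
  · rw [min_eq_left hk]
  · rw [min_eq_right hk]
    induction k, hk using Nat.le_induction with
    | base => rfl
    | succ k hk ih =>
      obtain ⟨j, rfl⟩ := Nat.exists_eq_add_of_le' (show 1 ≤ k by omega)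
      rw [← ih]
      exact h.take_stable w m j (by omega)

end NormalForm

/-! ### Fixed points -/

@[simp] lemma length_factorAt (α : ℕ → A) (i n : ℕ) : (factorAt α i n).length = n := by
  simp [factorAt]

@[simp] lemma factorAt_zero (α : ℕ → A) (i : ℕ) : factorAt α i 0 = [] := rfl

@[simp] lemma factorAt_one (α : ℕ → A) (i : ℕ) : factorAt α i 1 = [α i] := rfl

lemma factorAt_add (α : ℕ → A) (i m n : ℕ) :
    factorAt α i (m + n) = factorAt α i m ++ factorAt α (i + m) n := by
  simp [factorAt, List.range_add, Function.comp_def, add_assoc]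

lemma factorAt_eq_append (α : ℕ → A) {i j k : ℕ} (hij : i ≤ j) (hjk : j ≤ k) :
    factorAt α i (k - i) = factorAt α i (j - i) ++ factorAt α j (k - j) := by
  have h := factorAt_add α i (j - i) (k - j)
  rwa [show j - i + (k - j) = k - i by omega, show i + (j - i) = j by omega] at h

lemma getElem_factorAt (α : ℕ → A) (i n j : ℕ) (hj : j < (factorAt α i n).length) :
    (factorAt α i n)[j] = α (i + j) := by
  simp [factorAt]

lemma factorAt_of_append {α : ℕ → A} {u v : List A} {i : ℕ}
    (h : u ++ v = factorAt α i (u ++ v).length) :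
    u = factorAt α i u.length ∧ v = factorAt α (i + u.length) v.length := by
  rw [List.length_append, factorAt_add] at h
  exact List.append_inj h (by simp)

/-- `α` is the limit of the iterated images of its first letter `a`. -/
structure FixedPoint (φ : A → List A) (a : A) (α : ℕ → A) : Prop where
  fixed : IsFixedSeq φ a α
  start : ∃ u, φ a = a :: u
  unbounded : ∀ C, ∃ n, C ≤ ((wordMap φ)^[n] [a]).length

/-- The position in `α` at which the `k`-th image of the letter at position `p` starts. -/
def imagePos (φ : A → List A) (α : ℕ → A) (k p : ℕ) : ℕ :=
  ((wordMap φ)^[k] (factorAt α 0 p)).length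

namespace FixedPoint

variable {φ : A → List A} {a : A} {α : ℕ → A}

lemma apply_zero (h : FixedPoint φ a α) : α 0 = a := by
  have := h.fixed 0
  simpa using this

lemma length_monotone (h : FixedPoint φ a α) :
    Monotone fun n => ((wordMap φ)^[n] [a]).length := by
  obtain ⟨u, hu⟩ := h.start
  refine monotone_nat_of_le_succ fun n => ?_
  rw [iterate_succ_wordMap_singleton]
  exact length_iterate_singleton_le φ n (by simp [hu])

lemma iterate_prefix (h : FixedPoint φ a α) (k p : ℕ) :
    (wordMap φ)^[k] (factorAt α 0 p) = factorAt α 0 (imagePos φ α k p) := by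
  obtain ⟨n, hn⟩ := h.unbounded p
  have h1 := h.fixed n
  have h2 := h.fixed (k + n)
  rw [Function.iterate_add_apply, ← h1, ← Nat.sub_zero (List.length ((wordMap φ)^[n] [a])),
    factorAt_eq_append α (Nat.zero_le p) hn, iterate_wordMap_append] at h2
  exact (factorAt_of_append h2.symm).1

lemma imagePos_add (φ : A → List A) (α : ℕ → A) (k p m : ℕ) :
    imagePos φ α k (p + m) = imagePos φ α k p + ((wordMap φ)^[k] (factorAt α p m)).length := by
  simp [imagePos, factorAt_add]

lemma imagePos_mono (φ : A → List A) (α : ℕ → A) (k : ℕ) : Monotone (imagePos φ α k) := by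
  intro p q hpq
  obtain ⟨m, rfl⟩ := Nat.exists_eq_add_of_le hpq
  rw [imagePos_add]
  omega

@[simp] lemma imagePos_zero_right (φ : A → List A) (α : ℕ → A) (k : ℕ) :
    imagePos φ α k 0 = 0 := by
  simp [imagePos]

@[simp] lemma imagePos_zero_left (φ : A → List A) (α : ℕ → A) (p : ℕ) :
    imagePos φ α 0 p = p := by
  simp [imagePos]

lemma imagePos_succ (h : FixedPoint φ a α) (k p : ℕ) :
    imagePos φ α (k + 1) p = imagePos φ α k (imagePos φ α 1 p) := by
  rw [imagePos, imagePos, ← h.iterate_prefix]; rfl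

lemma iterate_factorAt (h : FixedPoint φ a α) (k : ℕ) {p q : ℕ} (hpq : p ≤ q) :
    (wordMap φ)^[k] (factorAt α p (q - p))
      = factorAt α (imagePos φ α k p) (imagePos φ α k q - imagePos φ α k p) := by
  have h1 := h.iterate_prefix k q
  have h2 := factorAt_eq_append α (Nat.zero_le p) hpq
  have h3 := factorAt_eq_append α (Nat.zero_le _) (imagePos_mono φ α k hpq)
  simp only [Nat.sub_zero] at h2 h3
  rw [h2, iterate_wordMap_append, h3, h.iterate_prefix k p] at h1
  exact List.append_cancel_left h1

lemma image_letter (h : FixedPoint φ a α) (p : ℕ) :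
    φ (α p) = factorAt α (imagePos φ α 1 p) (imagePos φ α 1 (p + 1) - imagePos φ α 1 p) := by
  rw [← h.iterate_factorAt 1 (Nat.le_succ p)]
  simp

lemma exists_le_imagePos (h : FixedPoint φ a α) (k C : ℕ) : ∃ p, C ≤ imagePos φ α k p := by
  obtain ⟨n, hn⟩ := h.unbounded C
  refine ⟨((wordMap φ)^[n] [a]).length, hn.trans ?_⟩
  rw [imagePos, h.fixed n, ← Function.iterate_add_apply]
  exact h.length_monotone (Nat.le_add_left n k)

/-- A factor of `α` that does not start at the origin straddles the `k`-th images of the two parts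
`u` and `v` of the image of a letter, for some `k`. -/
lemma exists_straddle (h : FixedPoint φ a α) {i : ℕ} (n : ℕ) (hi : 0 < i) :
    ∃ k p u v S T, φ (α p) = u ++ v ∧ factorAt α i n = S ++ T ∧
      S <:+ (wordMap φ)^[k] u ∧ T <+: (wordMap φ)^[k] v := by
  classical
  have hex : ∃ k, ¬ ∃ p, i ≤ imagePos φ α k p ∧ imagePos φ α k p ≤ i + n := by
    obtain ⟨k, hk⟩ := h.unbounded (i + n + 1)
    refine ⟨k, ?_⟩
    rintro ⟨p, hp1, hp2⟩
    have hp : 1 ≤ p := by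
      rcases Nat.eq_zero_or_pos p with rfl | hp
      · simp at hp1; omega
      · exact hp
    have h1 := imagePos_mono φ α k hp
    rw [imagePos, factorAt_one, h.apply_zero] at h1
    omega
  obtain ⟨k, hk⟩ : ∃ k, k + 1 = Nat.find hex := by
    refine ⟨Nat.find hex - 1, Nat.sub_add_cancel ?_⟩
    rw [Nat.one_le_iff_ne_zero, Ne, Nat.find_eq_zero, not_not]
    exact ⟨i, by simp, by simp⟩
  have hnot := Nat.find_spec hex
  have hyes := Nat.find_min hex (m := k) (by omega)
  rw [← hk] at hnot
  push Not at hnot hyes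
  obtain ⟨p₀, hp₀, hp₀'⟩ := hyes
  have hex' := h.exists_le_imagePos (k + 1) i
  obtain ⟨p, hp⟩ : ∃ p, p + 1 = Nat.find hex' := by
    refine ⟨Nat.find hex' - 1, Nat.sub_add_cancel ?_⟩
    rw [Nat.one_le_iff_ne_zero, Ne, Nat.find_eq_zero, imagePos_zero_right]
    omega
  have hge := Nat.find_spec hex'
  have hlt := Nat.find_min hex' (m := p) (by omega)
  rw [← hp] at hge
  have hgt := hnot _ hge
  rw [h.imagePos_succ] at hgt hlt
  have hP : imagePos φ α 1 p ≤ p₀ := by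
    by_contra! hlt'
    have := imagePos_mono φ α k hlt'.le
    omega
  have hQ : p₀ ≤ imagePos φ α 1 (p + 1) := by
    by_contra! hlt'
    have := imagePos_mono φ α k hlt'.le
    omega
  refine ⟨k, p, factorAt α (imagePos φ α 1 p) (p₀ - imagePos φ α 1 p),
    factorAt α p₀ (imagePos φ α 1 (p + 1) - p₀),
    factorAt α i (imagePos φ α k p₀ - i),
    factorAt α (imagePos φ α k p₀) (i + n - imagePos φ α k p₀), ?_, ?_, ?_, ?_⟩
  · rw [h.image_letter, factorAt_eq_append α hP hQ]
  · rw [← factorAt_eq_append α hp₀ hp₀']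
    simp
  · rw [h.iterate_factorAt k hP, factorAt_eq_append α (not_le.1 hlt).le hp₀]
    exact List.suffix_append _ _
  · rw [h.iterate_factorAt k hQ, factorAt_eq_append α hp₀' hgt.le]
    exact List.prefix_append _ _

end FixedPoint

/-! ### The quadratic upper bound -/

lemma finite_setOf_factor [Fintype A] (α : ℕ → A) (n : ℕ) :
    {w : List A | w.length = n ∧ IsFactor α w}.Finite :=
  (List.finite_length_eq A n).subset fun _ hw => hw.1

lemma exists_length_le [Fintype A] (φ : A → List A) : ∃ K, ∀ x, (φ x).length ≤ K :=
  ⟨∑ x, (φ x).length, fun x => Finset.single_le_sum (f := fun x => (φ x).length)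
    (fun _ _ => Nat.zero_le _) (Finset.mem_univ x)⟩

lemma complexity_le_of_normalForm [Fintype A] {φ : A → List A} {B : A → Prop} {a : A} {α : ℕ → A}
    (hN : NormalForm φ B) (h : FixedPoint φ a α) :
    ∃ C, ∀ n, complexity α n ≤ C * (n + 1) ^ 2 := by
  classical
  obtain ⟨K, hK⟩ := exists_length_le φ
  refine ⟨Fintype.card A * (K + 1) * 4 + 1, fun n => ?_⟩
  let f : A × ℕ × ℕ × ℕ → List A := fun x =>
    (((wordMap (mirror φ))^[x.2.2.1] ((φ x.1).take x.2.1).reverse).take x.2.2.2).reverse ++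
      ((wordMap φ)^[x.2.2.1] ((φ x.1).drop x.2.1)).take (n - x.2.2.2)
  let I : Finset (A × ℕ × ℕ × ℕ) := Finset.univ ×ˢ Finset.range (K + 1) ×ˢ
    Finset.range (2 * n + 4) ×ˢ Finset.range (n + 1)
  have hsub : {w : List A | w.length = n ∧ IsFactor α w} ⊆
      (insert (factorAt α 0 n) (I.image f) : Finset (List A)) := by
    rintro w ⟨hw, i, hi⟩
    rw [hw] at hi
    rw [Finset.coe_insert]
    rcases Nat.eq_zero_or_pos i with rfl | hpos
    · exact Or.inl hi
    right
    obtain ⟨k, p, u, v, S, T, huv, hST, hS, hT⟩ := h.exists_straddle n hpos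
    have hlen : S.length + T.length = n := by
      rw [← List.length_append, ← hST, length_factorAt]
    have hulen : u.length ≤ K := by
      have := hK (α p)
      rw [huv, List.length_append] at this
      omega
    rw [Finset.mem_coe, Finset.mem_image]
    refine ⟨(α p, u.length, min k (2 * n + 3), S.length), ?_, ?_⟩
    · simp only [I, Finset.mem_product, Finset.mem_univ, Finset.mem_range, true_and]
      omega
    · simp only [f, huv, List.take_left, List.drop_left]
      rw [hi, hST, ← hN.take_eq_take_min v (show n - S.length ≤ n by omega) k,
        ← hN.mirror.take_eq_take_min u.reverse (show S.length ≤ n by omega) k,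
        show n - S.length = T.length by omega, ← List.prefix_iff_eq_take.1 hT,
        iterate_wordMap_mirror, List.reverse_reverse]
      congr 1
      rw [← List.length_reverse (as := S),
        ← List.prefix_iff_eq_take.1 (List.reverse_prefix.2 hS), List.reverse_reverse]
  calc complexity α n
      ≤ (insert (factorAt α 0 n) (I.image f) : Finset (List A)).card := by
        rw [← Set.ncard_coe_finset]
        exact Set.ncard_le_ncard hsub (Finset.finite_toSet _)
    _ ≤ (I.image f).card + 1 := Finset.card_insert_le _ _
    _ ≤ I.card + 1 := by gcongr; exact Finset.card_image_le
    _ = Fintype.card A * (K + 1) * ((2 * n + 4) * (n + 1)) + 1 := by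
        simp only [I, Finset.card_product, Finset.card_range, Finset.card_univ]
        ring
    _ ≤ Fintype.card A * (K + 1) * (4 * (n + 1) ^ 2) + (n + 1) ^ 2 := by
        have h1 : (2 * n + 4) * (n + 1) ≤ 4 * (n + 1) ^ 2 := by nlinarith
        have h2 : 1 ≤ (n + 1) ^ 2 := Nat.one_le_pow _ _ (by omega)
        exact Nat.add_le_add (Nat.mul_le_mul_left _ h1) h2
    _ = _ := by ring

/-! ### The quadratic lower bound -/

lemma sq_le_complexity_of_blocks [Fintype A] {α : ℕ → A} {B : A → Prop} {e m : ℕ} (hm : 1 ≤ m)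
    (H : ∀ k, ∃ P, k ≤ P ∧ ¬ B (α P) ∧ (∀ j < e + k * m, B (α (P + 1 + j))) ∧
      ¬ B (α (P + 1 + (e + k * m)))) (n : ℕ) (hn : 2 * (e + 2) ≤ n) :
    (n / (8 * m)) ^ 2 ≤ complexity α n := by
  classical
  choose P hkP hP hB hP' using H
  set q := n / (8 * m) with hq
  have hqn : 8 * (q * m) ≤ n := by
    have := Nat.div_mul_le_self n (8 * m)
    rw [← hq] at this
    linarith
  have hqm : q ≤ q * m := Nat.le_mul_of_pos_right q hm
  let f : ℕ × ℕ → List A := fun x => factorAt α (P x.2 - x.1) n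
  let I : Finset (ℕ × ℕ) := Finset.range q ×ˢ Finset.Ico q (2 * q)
  have hI : ∀ x ∈ I, x.1 < q ∧ q ≤ x.2 ∧ x.1 ≤ P x.2 ∧ q * m ≤ x.2 * m ∧
      x.2 * m ≤ 2 * (q * m) := by
    intro x hx
    simp only [I, Finset.mem_product, Finset.mem_range, Finset.mem_Ico] at hx
    have h1 := Nat.mul_le_mul_right m hx.2.1
    have h2 := Nat.mul_le_mul_right m hx.2.2.le
    have h3 := hkP x.2
    rw [mul_assoc] at h2
    omega
  have hval : ∀ x ∈ I, ∀ y ∈ I, f x = f y → ∀ j < n,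
      α (P x.2 - x.1 + j) = α (P y.2 - y.1 + j) := by
    intro x _ y _ hxy j hj
    have := List.getElem_of_eq hxy (i := j) (by simpa [f] using hj)
    simpa only [f, getElem_factorAt] using this
  have hfst : ∀ x ∈ I, ∀ y ∈ I, f x = f y → ¬ x.1 < y.1 := by
    intro x hx y hy hxy hlt
    have h1 := hI x hx
    have h2 := hI y hy
    have h3 := hval x hx y hy hxy y.1 (by omega)
    rw [show P x.2 - x.1 + y.1 = P x.2 + 1 + (y.1 - x.1 - 1) by omega,
      show P y.2 - y.1 + y.1 = P y.2 by omega] at h3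
    exact hP y.2 (h3 ▸ hB x.2 _ (by omega))
  have hsnd : ∀ x ∈ I, ∀ y ∈ I, f x = f y → x.1 = y.1 → ¬ x.2 < y.2 := by
    intro x hx y hy hxy heq hlt
    have h1 := hI x hx
    have h2 := hI y hy
    have hlt' := Nat.mul_lt_mul_of_pos_right hlt hm
    have h3 := hval x hx y hy hxy (x.1 + 1 + (e + x.2 * m)) (by omega)
    rw [show P x.2 - x.1 + (x.1 + 1 + (e + x.2 * m)) = P x.2 + 1 + (e + x.2 * m) by omega,
      show P y.2 - y.1 + (x.1 + 1 + (e + x.2 * m)) = P y.2 + 1 + (e + x.2 * m) by omega] at h3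
    exact hP' x.2 (h3 ▸ hB y.2 _ (by omega))
  have hinj : Set.InjOn f I := by
    intro x hx y hy hxy
    have h1 := hfst x hx y hy hxy
    have h2 := hfst y hy x hx hxy.symm
    have h3 : x.1 = y.1 := by omega
    have h4 := hsnd x hx y hy hxy h3
    have h5 := hsnd y hy x hx hxy.symm h3.symm
    exact Prod.ext h3 (by omega)
  calc q ^ 2 = I.card := by
        simp only [I, Finset.card_product, Finset.card_range, Nat.card_Ico]
        rw [show 2 * q - q = q by omega, sq]
    _ = (I.image f).card := (Finset.card_image_of_injOn hinj).symm
    _ ≤ complexity α n := by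
        rw [← Set.ncard_coe_finset]
        refine Set.ncard_le_ncard ?_ (finite_setOf_factor α n)
        intro w hw
        obtain ⟨x, -, rfl⟩ := Finset.mem_image.1 (Finset.mem_coe.1 hw)
        exact ⟨length_factorAt _ _ _, P x.2 - x.1, by simp [f]⟩

lemma length_wordMap_le {φ : A → List A} {K : ℕ} (hK : ∀ x, (φ x).length ≤ K) (w : List A) :
    (wordMap φ w).length ≤ K * w.length := by
  induction w with
  | nil => simp
  | cons b w ih =>
    have := hK b
    simp only [wordMap_cons, List.length_append, List.length_cons]
    linarith

lemma length_le_of_prefix {B : A → Prop} {T t r : List A} {g : A} (hT : T <+: t ++ g :: r)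
    (hTB : ∀ x ∈ T, B x) (hg : ¬ B g) : T.length ≤ t.length := by
  by_contra! hlt
  have h1 : t ++ [g] <+: t ++ g :: r := ⟨r, by simp⟩
  have h2 : t ++ [g] <+: T := List.prefix_of_prefix_length_le h1 hT (by simpa using hlt)
  exact hg (hTB g (h2.subset (by simp)))

namespace NormalForm

variable {φ : A → List A} {B : A → Prop}

lemma length_iterate_le (h : NormalForm φ B) {K : ℕ} (hK : ∀ x, (φ x).length ≤ K) {w : List A}
    (hw : ∀ x ∈ w, B x) (k : ℕ) : ((wordMap φ)^[k] w).length ≤ (K + 1) * w.length := by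
  cases k with
  | zero => simp only [Function.iterate_zero, id_eq]; nlinarith
  | succ k =>
    rw [h.iterate_succ hw]
    have := length_wordMap_le hK w
    linarith

lemma iterate_self_of_erased {d : A} {t r : List A} (hd : φ d = t ++ d :: r)
    (ht : wordMap φ t = []) (k : ℕ) :
    ∃ t' r', (wordMap φ)^[k] [d] = t' ++ d :: r' ∧ (t' = [] ∨ t' = t) := by
  induction k with
  | zero => exact ⟨[], [], rfl, Or.inl rfl⟩
  | succ k ih =>
    obtain ⟨t', r', hk, ht'⟩ := ih
    have ht'' : wordMap φ t' = [] := by rcases ht' with rfl | rfl <;> simp [ht]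
    refine ⟨t, r ++ wordMap φ r', ?_, Or.inr rfl⟩
    rw [Function.iterate_succ_apply', hk]
    simp [ht'', hd]

/-- If no letter leading its own image produces persistent letters of `B` on its left, then the
prefixes in `B` of iterated images have bounded length. -/
lemma length_prefix_le (h : NormalForm φ B) {K : ℕ} (hK : ∀ x, (φ x).length ≤ K) {O : A → Prop}
    (hO : ∀ b, O b → ∀ x ∈ φ b, O x)
    (hlead : ∀ d t r, O d → ¬ B d → φ d = t ++ d :: r → (∀ x ∈ t, B x) → wordMap φ t = [])
    {v : List A} (hv : ∀ x ∈ v, O x) (k : ℕ) {T : List A} (hT : T <+: (wordMap φ)^[k] v)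
    (hTB : ∀ x ∈ T, B x) : T.length ≤ (K + 1) * v.length + ((K + 1) * K + K) := by
  rcases exists_first_not (B := B) v with hvB | ⟨t, b, r, rfl, ht, hb⟩
  · have := h.length_iterate_le hK hvB k
    have := hT.length_le
    omega
  cases k with
  | zero =>
    have := hT.length_le
    simp only [Function.iterate_zero, id_eq] at this
    nlinarith
  | succ k =>
    obtain ⟨b', ⟨t₁, r₁, hb₁, ht₁, -⟩, t₂, r₂, hb₂, ht₂, hb'⟩ := h.lead b hb
    have hOb' : O b' := hO b (hv b (by simp)) b' (by simp [hb₁])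
    obtain ⟨t₃, r₃, hk, ht₃⟩ := iterate_self_of_erased hb₂ (hlead b' t₂ r₂ hOb' hb' hb₂ ht₂) k
    have hlen₃ : t₃.length ≤ K := by
      have := hK b'
      rw [hb₂] at this
      rcases ht₃ with rfl | rfl <;> simp at this ⊢
      omega
    have hlen₁ : t₁.length ≤ K := by
      have := hK b
      rw [hb₁] at this
      simp at this
      omega
    have heq : (wordMap φ)^[k + 1] (t ++ b :: r) =
        ((wordMap φ)^[k + 1] t ++ (wordMap φ)^[k] t₁ ++ t₃)
        ++ b' :: (r₃ ++ (wordMap φ)^[k] r₁ ++ (wordMap φ)^[k + 1] r) := by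
      rw [iterate_wordMap_append, iterate_wordMap_cons, iterate_succ_wordMap_singleton, hb₁,
        iterate_wordMap_append, iterate_wordMap_cons φ k b', hk]
      simp
    rw [heq] at hT
    have h1 := length_le_of_prefix hT hTB hb'
    have h2 := h.length_iterate_le hK ht (k + 1)
    have h3 := h.length_iterate_le hK ht₁ k
    simp only [List.length_append, List.length_cons] at h1 ⊢
    nlinarith

lemma exists_not_mem_iterate (h : NormalForm φ B) {w : List A} (hw : ∃ g ∈ w, ¬ B g) (k : ℕ) :
    ∃ g ∈ (wordMap φ)^[k] w, ¬ B g := by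
  induction k with
  | zero => exact hw
  | succ k ih =>
    obtain ⟨g, hg, hgB⟩ := ih
    obtain ⟨g', ⟨t, r, hgt, -, hg'⟩, -⟩ := h.lead g hgB
    refine ⟨g', ?_, hg'⟩
    rw [Function.iterate_succ_apply', wordMap, List.mem_flatMap]
    exact ⟨g, hg, by simp [hgt]⟩

end NormalForm

lemma FixedPoint.occurs_image {φ : A → List A} {a : A} {α : ℕ → A} (h : FixedPoint φ a α) (b : A)
    (hb : ∃ p, α p = b) (x : A) (hx : x ∈ φ b) : ∃ p, α p = x := by
  obtain ⟨p, rfl⟩ := hb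
  rw [h.image_letter, factorAt] at hx
  obtain ⟨j, -, hj⟩ := List.mem_map.1 hx
  exact ⟨_, hj⟩

/-- If `α` has arbitrarily long factors in `B`, then some letter of `α` outside `B` produces
persistent letters of `B` next to itself. -/
lemma exists_productive_letter [Fintype A] {φ : A → List A} {B : A → Prop} {a : A} {α : ℕ → A}
    (hN : NormalForm φ B) (h : FixedPoint φ a α) (ha : ¬ B a)
    (hub : ∀ C, ∃ w, IsFactor α w ∧ (∀ b ∈ w, B b) ∧ C < w.length) :
    (∃ p r s, ¬ B (α p) ∧ φ (α p) = r ++ α p :: s ∧ (∀ x ∈ s, B x) ∧ wordMap φ s ≠ []) ∨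
    (∃ p t r, ¬ B (α p) ∧ φ (α p) = t ++ α p :: r ∧ (∀ x ∈ t, B x) ∧ wordMap φ t ≠ []) := by
  by_contra! hcon
  obtain ⟨hcon₁, hcon₂⟩ := hcon
  obtain ⟨K, hK⟩ := exists_length_le φ
  have hK' : ∀ x, (mirror φ x).length ≤ K := fun x => by simpa [mirror] using hK x
  have hO := h.occurs_image
  have hO' : ∀ b, (∃ p, α p = b) → ∀ x ∈ mirror φ b, ∃ p, α p = x :=
    fun b hb x hx => hO b hb x (by simpa [mirror] using hx)
  obtain ⟨w, ⟨i, hi⟩, hwB, hlen⟩ := hub (2 * ((K + 1) * K + ((K + 1) * K + K)))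
  rcases Nat.eq_zero_or_pos i with rfl | hpos
  · apply ha
    have hw : 0 < w.length := by omega
    have h0 := hwB w[0] (List.getElem_mem hw)
    rw [List.getElem_of_eq hi hw, getElem_factorAt] at h0
    rwa [← h.apply_zero]
  obtain ⟨k, p, u, v, S, T, huv, hST, hS, hT⟩ := h.exists_straddle w.length hpos
  rw [← hi] at hST
  have hlen' := hK (α p)
  rw [huv, List.length_append] at hlen'
  have hOuv : ∀ x ∈ u ++ v, ∃ p, α p = x := fun x hx => hO (α p) ⟨p, rfl⟩ x (huv ▸ hx)
  have hTlen := hN.length_prefix_le hK hO (by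
    rintro d t r ⟨p, rfl⟩ hd hdt ht
    exact hcon₂ p t r hd hdt ht) (v := v) (fun x hx => hOuv x (by simp [hx])) k hT
    (fun x hx => hwB x (by simp [hST, hx]))
  have hSlen := hN.mirror.length_prefix_le hK' hO' (by
    rintro d t r ⟨p, rfl⟩ hd hdt ht
    have hdt' : φ (α p) = r.reverse ++ α p :: t.reverse := by
      rw [mirror, List.reverse_eq_iff] at hdt
      simpa using hdt
    rw [wordMap_mirror, hcon₁ p _ _ hd hdt' (by simpa using ht)]
    rfl) (v := u.reverse) (fun x hx => hOuv x (by simp at hx; simp [hx])) k (T := S.reverse)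
    (by rw [iterate_wordMap_mirror, List.reverse_reverse]; exact List.reverse_prefix.2 hS)
    (fun x hx => hwB x (by simp at hx; simp [hST, hx]))
  rw [List.length_reverse, List.length_reverse] at hSlen
  have h1 := Nat.mul_le_mul_left (K + 1) (show u.length ≤ K by omega)
  have h2 := Nat.mul_le_mul_left (K + 1) (show v.length ≤ K by omega)
  rw [hST, List.length_append] at hlen
  omega

/-- The word `w`, all of whose letters are in `B`, occurs in `α` after the prefix `x ++ [c]` and
before `d`, where `c` and `d` are not in `B`. -/
structure IsBlock (B : A → Prop) (α : ℕ → A) (x : List A) (c : A) (w : List A) (d : A) : Prop where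
  occurs : ∃ y, x ++ c :: (w ++ d :: y) = factorAt α 0 (x ++ c :: (w ++ d :: y)).length
  bounded : ∀ b ∈ w, B b
  left : ¬ B c
  right : ¬ B d

namespace IsBlock

variable {φ : A → List A} {B : A → Prop} {a : A} {α : ℕ → A}

lemma image {x w r s t r' : List A} {c d c' d' : A} (hb : IsBlock B α x c w d)
    (hN : NormalForm φ B) (h : FixedPoint φ a α) (hc : φ c = r ++ c' :: s) (hs : ∀ b ∈ s, B b)
    (hc' : ¬ B c') (hd : φ d = t ++ d' :: r') (ht : ∀ b ∈ t, B b) (hd' : ¬ B d') :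
    IsBlock B α (wordMap φ x ++ r) c' (s ++ wordMap φ w ++ t) d' where
  occurs := by
    obtain ⟨y, hy⟩ := hb.occurs
    refine ⟨r' ++ wordMap φ y, ?_⟩
    have h1 := h.iterate_prefix 1 (x ++ c :: (w ++ d :: y)).length
    rw [imagePos, ← hy] at h1
    simpa [hc, hd] using h1
  bounded b hbm := by
    simp only [List.mem_append] at hbm
    rcases hbm with (hbm | hbm) | hbm
    · exact hs b hbm
    · exact hN.closed_wordMap hb.bounded b hbm
    · exact ht b hbm
  left := hc'
  right := hd'

lemma positions {x w : List A} {c d : A} (hb : IsBlock B α x c w d) :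
    ¬ B (α x.length) ∧ (∀ j < w.length, B (α (x.length + 1 + j))) ∧
      ¬ B (α (x.length + 1 + w.length)) := by
  obtain ⟨y, hy⟩ := hb.occurs
  have h1 := (factorAt_of_append hy).2
  rw [zero_add, ← List.singleton_append] at h1
  obtain ⟨h2, h3⟩ := factorAt_of_append h1
  obtain ⟨h4, h5⟩ := factorAt_of_append h3
  simp only [List.length_singleton] at h2 h4 h5
  refine ⟨?_, ?_, ?_⟩
  · have : c = α x.length := by simpa using h2
    exact this ▸ hb.left
  · intro j hj
    have := hb.bounded w[j] (List.getElem_mem hj)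
    rwa [List.getElem_of_eq h4 hj, getElem_factorAt] at this
  · rw [← List.singleton_append] at h5
    have : d = α (x.length + 1 + w.length) := by simpa using (factorAt_of_append h5).1
    exact this ▸ hb.right

/-- Iterating the morphism on a block whose bordering letters trail and lead their own images. -/
lemma iterate {x w r s t r' : List A} {c d : A} (hb : IsBlock B α x c w d)
    (hN : NormalForm φ B) (h : FixedPoint φ a α) (hc : φ c = r ++ c :: s) (hs : ∀ b ∈ s, B b)
    (hd : φ d = t ++ d :: r') (ht : ∀ b ∈ t, B b) (k : ℕ) :
    ∃ z w', IsBlock B α ((wordMap φ)^[k] x ++ z) c w' d ∧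
      (wordMap φ w').length
        = (wordMap φ w).length + k * ((wordMap φ s).length + (wordMap φ t).length) := by
  induction k with
  | zero => exact ⟨[], w, by simpa using hb, by simp⟩
  | succ k ih =>
    obtain ⟨z, w', hb', hlen⟩ := ih
    refine ⟨wordMap φ z ++ r, s ++ wordMap φ w' ++ t, ?_, ?_⟩
    · have := hb'.image hN h hc hs hb.left hd ht hb.right
      rw [Function.iterate_succ_apply']
      simpa using this
    · simp only [wordMap_append, List.length_append, hN.idem_wordMap hb'.bounded, hlen]
      ring

lemma sq_le_complexity [Fintype A] {x w r s t r' : List A} {c d : A} (hb : IsBlock B α x c w d)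
    (hx : x ≠ []) (ha : ¬ B a) (hN : NormalForm φ B) (h : FixedPoint φ a α)
    (hc : φ c = r ++ c :: s) (hs : ∀ b ∈ s, B b) (hd : φ d = t ++ d :: r') (ht : ∀ b ∈ t, B b)
    (hst : wordMap φ s ≠ [] ∨ wordMap φ t ≠ []) :
    ∃ e m, 1 ≤ m ∧ ∀ n, 2 * (e + 2) ≤ n → (n / (8 * m)) ^ 2 ≤ complexity α n := by
  refine ⟨s.length + (wordMap φ w).length + t.length,
    (wordMap φ s).length + (wordMap φ t).length, ?_⟩
  have hm : 1 ≤ (wordMap φ s).length + (wordMap φ t).length := by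
    rcases hst with hst | hst <;> have := List.length_pos_of_ne_nil hst <;> omega
  have hax : a ∈ x := by
    obtain ⟨y, hy⟩ := hb.occurs
    obtain ⟨b, x, rfl⟩ := List.exists_cons_of_ne_nil hx
    have h1 := (factorAt_of_append hy).1
    have h2 := List.getElem_of_eq h1 (i := 0) (by simp)
    rw [getElem_factorAt, zero_add, h.apply_zero] at h2
    simp at h2
    simp [h2]
  refine ⟨hm, sq_le_complexity_of_blocks (B := B) hm fun k => ?_⟩
  obtain ⟨z, w', hb', hlen⟩ := hb.iterate hN h hc hs hd ht k
  have hb'' := hb'.image hN h hc hs hb.left hd ht hb.right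
  obtain ⟨h1, h2, h3⟩ := hb''.positions
  have hl : (s ++ wordMap φ w' ++ t).length = s.length + (wordMap φ w).length + t.length
      + k * ((wordMap φ s).length + (wordMap φ t).length) := by
    simp only [List.length_append, hlen]
    ring
  rw [hl] at h2 h3
  refine ⟨_, ?_, h1, h2, h3⟩
  have h4 := hN.length_iterate ha (k + 1)
  have h5 := length_iterate_singleton_le φ (k + 1) hax
  rw [Function.iterate_succ_apply' (wordMap φ) k x] at h5
  simp only [wordMap_append, List.length_append]
  omega

end IsBlock

section LowerBound

variable {φ : A → List A} {B : A → Prop} {a : A} {α : ℕ → A}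

lemma isBlock_of_positions {p q : ℕ} (hpq : p < q) (hp : ¬ B (α p)) (hq : ¬ B (α q))
    (hB : ∀ j, p < j → j < q → B (α j)) :
    IsBlock B α (factorAt α 0 p) (α p) (factorAt α (p + 1) (q - (p + 1))) (α q) where
  occurs := by
    refine ⟨[], ?_⟩
    have h1 := factorAt_eq_append α (Nat.zero_le p) (show p ≤ q + 1 by omega)
    have h2 := factorAt_eq_append α (Nat.le_succ p) (show p + 1 ≤ q + 1 by omega)
    have h3 := factorAt_eq_append α hpq (Nat.le_succ q)
    simp only [Nat.sub_zero, Nat.add_sub_cancel_left, factorAt_one, Nat.succ_eq_add_one]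
      at h1 h2 h3
    rw [h2, h3] at h1
    have hlen := congrArg List.length h1
    rw [length_factorAt] at hlen
    rw [List.singleton_append] at h1 hlen
    rw [← hlen, h1]
  bounded b hb := by
    obtain ⟨j, hj, rfl⟩ := List.mem_map.1 hb
    rw [List.mem_range] at hj
    exact hB _ (by omega) (by omega)
  left := hp
  right := hq

lemma IsBlock.image_prefix_ne_nil {x w r s u : List A} {c d c' : A} (hb : IsBlock B α x c w d)
    (h : FixedPoint φ a α) (hu : φ a = a :: u) (hg : ∃ g ∈ u, ¬ B g) (hc : φ c = r ++ c' :: s)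
    (hs : ∀ b ∈ s, B b) : wordMap φ x ++ r ≠ [] := by
  intro hnil
  obtain ⟨hx, rfl⟩ := List.append_eq_nil_iff.1 hnil
  obtain ⟨y, hy⟩ := hb.occurs
  cases x with
  | nil =>
    have h2 := List.getElem_of_eq hy (i := 0) (by simp)
    rw [getElem_factorAt, zero_add, h.apply_zero] at h2
    simp only [List.nil_append, List.getElem_cons_zero] at h2
    rw [h2, hu, List.nil_append, List.cons.injEq] at hc
    obtain ⟨g, hgu, hgB⟩ := hg
    exact hgB (hs g (hc.2 ▸ hgu))
  | cons b x =>
    have h2 := List.getElem_of_eq hy (i := 0) (by simp)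
    rw [getElem_factorAt, zero_add, h.apply_zero] at h2
    simp only [List.cons_append, List.getElem_cons_zero] at h2
    simp [h2, hu] at hx

lemma exists_not_mem_ge (hN : NormalForm φ B) (h : FixedPoint φ a α) (ha : ¬ B a) {u : List A}
    (hu : φ a = a :: u) (hg : ∃ g ∈ u, ¬ B g) (N : ℕ) : ∃ p, N ≤ p ∧ ¬ B (α p) := by
  obtain ⟨g, hgm, hgB⟩ := hN.exists_not_mem_iterate hg N
  have h1 := (h.fixed (N + 1)).symm
  rw [iterate_succ_wordMap_singleton, hu, iterate_wordMap_cons] at h1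
  rw [(factorAt_of_append h1).2] at hgm
  obtain ⟨j, -, rfl⟩ := List.mem_map.1 hgm
  refine ⟨_, ?_, hgB⟩
  have := hN.length_iterate ha N
  omega

lemma exists_sq_le_complexity [Fintype A] (hN : NormalForm φ B) (h : FixedPoint φ a α) (ha : ¬ B a)
    {u : List A} (hu : φ a = a :: u) (hg : ∃ g ∈ u, ¬ B g)
    (hub : ∀ C, ∃ w, IsFactor α w ∧ (∀ b ∈ w, B b) ∧ C < w.length) :
    ∃ e m, 1 ≤ m ∧ ∀ n, 2 * (e + 2) ≤ n → (n / (8 * m)) ^ 2 ≤ complexity α n := by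
  classical
  rcases exists_productive_letter hN h ha hub with
    ⟨p, r, s, hp, hc, hs, hne⟩ | ⟨q, t, r', hq, hd, ht, hne⟩
  · have hex := exists_not_mem_ge hN h ha hu hg (p + 1)
    obtain ⟨hpq, hq⟩ := Nat.find_spec hex
    have hmin : ∀ j, p < j → j < Nat.find hex → B (α j) := by
      intro j hj hlt
      by_contra hB
      exact Nat.find_min hex hlt ⟨hj, hB⟩
    have hb := isBlock_of_positions hpq hp hq hmin
    obtain ⟨d', ⟨t, r', hd, ht, hd'⟩, t₂, r₂, hd₂, ht₂, -⟩ := hN.lead _ hq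
    exact (hb.image hN h hc hs hp hd ht hd').sq_le_complexity
      (hb.image_prefix_ne_nil h hu hg hc hs) ha hN h hc hs hd₂ ht₂ (Or.inl hne)
  · have hpos : 0 < q := by
      rcases Nat.eq_zero_or_pos q with rfl | hpos
      · exfalso
        cases t with
        | nil => exact hne rfl
        | cons b t =>
          rw [h.apply_zero, hu, List.cons_append, List.cons.injEq] at hd
          exact ha (ht a (by simp [hd.1]))
      · exact hpos
    have hex : ∃ j, ¬ B (α (q - 1 - j)) := ⟨q - 1, by simpa [h.apply_zero] using ha⟩
    have hp := Nat.find_spec hex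
    have hmin : ∀ j, q - 1 - Nat.find hex < j → j < q → B (α j) := by
      intro j hj hlt
      by_contra hB
      exact Nat.find_min hex (m := q - 1 - j) (by omega)
        (by rwa [show q - 1 - (q - 1 - j) = j by omega])
    have hb := isBlock_of_positions (by omega) hp hq hmin
    obtain ⟨c', hcc, hcs⟩ := hN.trail _ hp
    obtain ⟨r, s, hc, hs, hc'⟩ := lead_mirror hcc
    obtain ⟨r₂, s₂, hc₂, hs₂, -⟩ := lead_mirror hcs
    exact (hb.image hN h hc hs hc' hd ht hq).sq_le_complexity
      (hb.image_prefix_ne_nil h hu hg hc hs) ha hN h hc₂ hs₂ hd ht (Or.inr hne)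

lemma ultimatelyPeriodic_of_bounded (hN : NormalForm φ B) (h : FixedPoint φ a α) (ha : ¬ B a)
    {u : List A} (hu : φ a = a :: u) (huB : ∀ x ∈ u, B x) : UltimatelyPeriodic α := by
  have hstep : ∀ k, (wordMap φ)^[k + 2] [a] = (wordMap φ)^[k + 1] [a] ++ wordMap φ u := by
    intro k
    rw [iterate_succ_wordMap_singleton, hu, iterate_wordMap_cons, hN.iterate_succ huB]
  have hlen : ∀ k, ((wordMap φ)^[k + 1] [a]).length = (φ a).length + k * (wordMap φ u).length := by
    intro k
    induction k with
    | zero => simp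
    | succ k ih => rw [hstep, List.length_append, ih]; ring
  have hfac : ∀ k, wordMap φ u
      = factorAt α ((φ a).length + k * (wordMap φ u).length) (wordMap φ u).length := by
    intro k
    have h1 := (h.fixed (k + 2)).symm
    rw [hstep] at h1
    have h2 := (factorAt_of_append h1).2
    rwa [zero_add, hlen] at h2
  have hpos : 1 ≤ (wordMap φ u).length := by
    by_contra! hzero
    have h1 := hN.length_iterate ha ((φ a).length + 1)
    rw [hlen, Nat.lt_one_iff.1 hzero] at h1
    omega
  refine ⟨(φ a).length, (wordMap φ u).length, hpos, fun i hi => ?_⟩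
  obtain ⟨i, rfl⟩ := Nat.exists_eq_add_of_le hi
  generalize hq : (wordMap φ u).length = q at *
  have h1 := (hfac (i / q + 1)).symm.trans (hfac (i / q))
  have hmod := Nat.mod_lt i hpos
  have h2 := List.getElem_of_eq h1 (i := i % q) (by simpa using hmod)
  rw [getElem_factorAt, getElem_factorAt] at h2
  have hdm := Nat.div_add_mod' i q
  rw [add_mul] at h2
  convert h2 using 2 <;> omega

end LowerBound

/-! ### Passing to a power in normal form -/

lemma exists_iterate_idem {X : Type*} {g : X → X} {x : X} {k q : ℕ} (hq : 0 < q)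
    (h : g^[k + q] x = g^[k] x) :
    ∃ P, 0 < P ∧ ∀ p, 0 < p → P ∣ p → g^[p + p] x = g^[p] x := by
  refine ⟨q * (k + 1), by positivity, fun p hp hdvd => ?_⟩
  have hper : Function.IsPeriodicPt g q (g^[k] x) := by
    rw [Function.IsPeriodicPt, Function.IsFixedPt, ← Function.iterate_add_apply, add_comm, h]
  have hkp : k ≤ p := by
    have h1 := Nat.le_of_dvd hp hdvd
    have h2 : k + 1 ≤ q * (k + 1) := Nat.le_mul_of_pos_left _ hq
    omega
  have h1 := (hper.apply_iterate (p - k)).trans_dvd ((Dvd.intro _ rfl).trans hdvd)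
  rw [← Function.iterate_add_apply, Nat.sub_add_cancel hkp] at h1
  rw [Function.iterate_add_apply]
  exact h1

lemma exists_iterate_idem_of_finite [Finite A] (F : A → A) (b : A) :
    ∃ P, 0 < P ∧ ∀ p, 0 < p → P ∣ p → F^[p + p] b = F^[p] b := by
  obtain ⟨i, j, hij, h⟩ := Finite.exists_ne_map_eq_of_infinite fun n : ℕ => F^[n] b
  wlog hlt : i < j generalizing i j
  · exact this j i hij.symm h.symm (by omega)
  obtain ⟨q, rfl⟩ := Nat.exists_eq_add_of_lt hlt
  exact exists_iterate_idem (k := i) (q := q + 1) (by omega) h.symm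

section Letters

variable {φ : A → List A}

lemma BoundedLetter.exists_iterate_eq [Finite A] {b : A} (hb : BoundedLetter φ b) :
    ∃ k q, 0 < q ∧ (wordMap φ)^[k + q] [b] = (wordMap φ)^[k] [b] := by
  rw [BoundedLetter, GrowingLetter, tendsto_atTop] at hb
  push Not at hb
  obtain ⟨C, hC⟩ := hb
  have hinf := Nat.frequently_atTop_iff_infinite.1 hC
  have hfin : {w : List A | w.length ≤ C}.Finite := List.finite_length_le A C
  obtain ⟨i, -, j, -, hij, h⟩ := hinf.exists_ne_map_eq_of_mapsTo
    (f := fun n => (wordMap φ)^[n] [b]) (t := {w : List A | w.length ≤ C})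
    (fun n (hn : ((wordMap φ)^[n] [b]).length < C) =>
      show ((wordMap φ)^[n] [b]).length ≤ C from hn.le) hfin
  wlog hlt : i < j generalizing i j
  · exact this j i hij.symm h.symm (by omega)
  obtain ⟨q, rfl⟩ := Nat.exists_eq_add_of_lt hlt
  exact ⟨i, q + 1, by omega, h.symm⟩

lemma BoundedLetter.exists_length_le [Finite A] {b : A} (hb : BoundedLetter φ b) :
    ∃ C, ∀ n, ((wordMap φ)^[n] [b]).length ≤ C := by
  obtain ⟨k, q, hq, h⟩ := hb.exists_iterate_eq
  refine ⟨∑ i ∈ Finset.range (k + q), ((wordMap φ)^[i] [b]).length, fun n => ?_⟩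
  induction n using Nat.strong_induction_on with
  | _ n ih =>
    rcases lt_or_ge n (k + q) with hn | hn
    · exact Finset.single_le_sum (f := fun i => ((wordMap φ)^[i] [b]).length)
        (fun _ _ => Nat.zero_le _) (Finset.mem_range.2 hn)
    · obtain ⟨m, rfl⟩ := Nat.exists_eq_add_of_le' hn
      rw [Function.iterate_add_apply, h, ← Function.iterate_add_apply]
      exact ih _ (by omega)

lemma exists_length_iterate_le [Finite A] {w : List A} (hw : ∀ x ∈ w, BoundedLetter φ x) :
    ∃ C, ∀ n, ((wordMap φ)^[n] w).length ≤ C := by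
  induction w with
  | nil => exact ⟨0, by simp⟩
  | cons b w ih =>
    simp only [List.mem_cons, forall_eq_or_imp] at hw
    obtain ⟨C, hC⟩ := ih hw.2
    obtain ⟨D, hD⟩ := hw.1.exists_length_le
    refine ⟨D + C, fun n => ?_⟩
    rw [iterate_wordMap_cons, List.length_append]
    exact Nat.add_le_add (hD n) (hC n)

lemma BoundedLetter.closed {b : A} (hb : BoundedLetter φ b) : ∀ x ∈ φ b, BoundedLetter φ x := by
  intro x hx hgrow
  refine hb ((tendsto_add_atTop_iff_nat 1).1 (tendsto_atTop_mono (fun k => ?_) hgrow))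
  rw [iterate_succ_wordMap_singleton]
  exact length_iterate_singleton_le φ k hx

lemma BoundedLetter.closed_iterate {w : List A} (hw : ∀ x ∈ w, BoundedLetter φ x) (k : ℕ) :
    ∀ x ∈ (wordMap φ)^[k] w, BoundedLetter φ x := by
  induction k with
  | zero => exact hw
  | succ k ih =>
    intro x hx
    rw [Function.iterate_succ_apply', wordMap, List.mem_flatMap] at hx
    obtain ⟨b, hb, hx⟩ := hx
    exact (ih b hb).closed x hx

lemma exists_lead [Finite A] {b : A} (hb : ¬ BoundedLetter φ b) :
    ∃ b', Lead φ (BoundedLetter φ) b b' := by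
  rcases exists_first_not (B := BoundedLetter φ) (φ b) with h | ⟨t, b', r, h, ht, hb'⟩
  · exfalso
    obtain ⟨C, hC⟩ := exists_length_iterate_le h
    rw [BoundedLetter, not_not, GrowingLetter, ← tendsto_add_atTop_iff_nat 1] at hb
    obtain ⟨k, hk⟩ := (hb.eventually_gt_atTop C).exists
    rw [iterate_succ_wordMap_singleton] at hk
    exact absurd (hC k) (by omega)
  · exact ⟨b', t, r, h, ht, hb'⟩

lemma boundedLetter_mirror {b : A} : BoundedLetter (mirror φ) b ↔ BoundedLetter φ b := by
  simp [BoundedLetter, GrowingLetter, iterate_wordMap_mirror]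

lemma lead_morphismPow {F : A → A}
    (hF : ∀ b, ¬ BoundedLetter φ b → Lead φ (BoundedLetter φ) b (F b)) {b : A}
    (hb : ¬ BoundedLetter φ b) (p : ℕ) :
    Lead (morphismPow φ p) (BoundedLetter φ) b (F^[p] b) := by
  induction p with
  | zero => exact ⟨[], [], rfl, by simp, hb⟩
  | succ p ih =>
    obtain ⟨t, r, h, ht, hbp⟩ := ih
    obtain ⟨t', r', h', ht', hbp'⟩ := hF _ hbp
    rw [Function.iterate_succ_apply']
    refine ⟨wordMap φ t ++ t', r' ++ wordMap φ r, ?_, ?_, hbp'⟩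
    · rw [morphismPow] at h ⊢
      rw [Function.iterate_succ_apply', h]
      simp [h']
    · intro x hx
      rcases List.mem_append.1 hx with hx | hx
      · exact BoundedLetter.closed_iterate ht 1 x hx
      · exact ht' x hx

lemma exists_lead_idem [Finite A] (φ : A → List A) : ∃ F : A → A,
    ∀ p, (∀ b, F^[p + p] b = F^[p] b) → ∀ b, ¬ BoundedLetter φ b →
      ∃ b', Lead (morphismPow φ p) (BoundedLetter φ) b b' ∧
        Lead (morphismPow φ p) (BoundedLetter φ) b' b' := by
  choose! F hF using fun (b : A) (hb : ¬ BoundedLetter φ b) => exists_lead hb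
  refine ⟨F, fun p hp b hb => ⟨F^[p] b, lead_morphismPow hF hb p, ?_⟩⟩
  have hb' : ¬ BoundedLetter φ (F^[p] b) := by
    obtain ⟨_, _, _, _, h⟩ := lead_morphismPow hF hb p
    exact h
  have := lead_morphismPow hF hb' p
  rwa [← Function.iterate_add_apply, hp] at this

lemma exists_normalForm [Fintype A] (φ : A → List A) :
    ∃ p, 0 < p ∧ NormalForm (morphismPow φ p) (BoundedLetter φ) := by
  classical
  obtain ⟨F, hF⟩ := exists_lead_idem φ
  obtain ⟨L, hL⟩ := exists_lead_idem (mirror φ)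
  choose P hP hPF using exists_iterate_idem_of_finite F
  choose Q hQ hQL using exists_iterate_idem_of_finite L
  have hR : ∀ b, ∃ R, 0 < R ∧ (BoundedLetter φ b → ∀ p, 0 < p → R ∣ p →
      (wordMap φ)^[p + p] [b] = (wordMap φ)^[p] [b]) := by
    intro b
    by_cases hb : BoundedLetter φ b
    · obtain ⟨k, q, hq, h⟩ := hb.exists_iterate_eq
      obtain ⟨R, hR, h⟩ := exists_iterate_idem hq h
      exact ⟨R, hR, fun _ => h⟩
    · exact ⟨1, one_pos, fun h => absurd h hb⟩
  choose R hR hRφ using hR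
  let p := ∏ b, P b * Q b * R b
  have hp : 0 < p := Finset.prod_pos fun b _ => by
    have := hP b
    have := hQ b
    have := hR b
    positivity
  have hdvd : ∀ b, P b * Q b * R b ∣ p := fun b =>
    Finset.dvd_prod_of_mem (fun b => P b * Q b * R b) (Finset.mem_univ b)
  have hPp : ∀ b, P b ∣ p := fun b => ((Dvd.intro _ rfl).mul_right _).trans (hdvd b)
  have hQp : ∀ b, Q b ∣ p := fun b => ((Dvd.intro_left _ rfl).mul_right _).trans (hdvd b)
  have hRp : ∀ b, R b ∣ p := fun b => (Dvd.intro_left _ rfl).trans (hdvd b)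
  refine ⟨p, hp, ?_, ?_, ?_, ?_, ?_⟩
  · intro b hb
    exact BoundedLetter.closed_iterate (w := [b]) (by simpa using hb) p
  · intro b hb
    rw [wordMap_morphismPow, morphismPow, ← Function.iterate_add_apply]
    exact hRφ b hb p hp (hRp b)
  · exact hF p fun b => hPF b p hp (hPp b)
  · have h1 := hL p fun b => hQL b p hp (hQp b)
    have h2 : BoundedLetter (mirror φ) = BoundedLetter φ := funext fun b =>
      propext boundedLetter_mirror
    rwa [h2, ← mirror_morphismPow] at h1
  · intro b hb C
    rw [BoundedLetter, not_not, GrowingLetter] at hb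
    have h1 := hb.comp ((strictMono_mul_left_of_pos hp).tendsto_atTop)
    obtain ⟨k, hk⟩ := (h1.eventually_ge_atTop C).exists
    exact ⟨k, by rw [iterate_wordMap_morphismPow]; exact hk⟩

end Letters

lemma fixedPoint_morphismPow {φ : A → List A} {a : A} {α : ℕ → A} (hpro : Prolongable φ a)
    (hfix : IsFixedSeq φ a α) {p : ℕ} (hp : 0 < p) : FixedPoint (morphismPow φ p) a α where
  fixed n := by rw [iterate_wordMap_morphismPow]; exact hfix _
  start := by
    obtain ⟨w, -, hw⟩ := hpro.1
    clear hp
    induction p with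
    | zero => exact ⟨[], rfl⟩
    | succ p ih =>
      obtain ⟨u, hu⟩ := ih
      refine ⟨w ++ wordMap φ u, ?_⟩
      rw [morphismPow] at hu ⊢
      rw [Function.iterate_succ_apply', hu]
      simp [hw]
  unbounded C := by
    have h1 := hpro.2.comp ((strictMono_mul_left_of_pos hp).tendsto_atTop)
    obtain ⟨k, hk⟩ := (h1.eventually_ge_atTop C).exists
    exact ⟨k, by rw [iterate_wordMap_morphismPow]; exact hk⟩

/-- A non-growing morphism whose fixed point has unbounded factors of bounded letters yields
complexity Θ(n²) (when not ultimately periodic). -/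
theorem nonGrowing_unbounded_complexity {A : Type*} [Fintype A] (φ : A → List A) (a : A)
    (α : ℕ → A) (hng : ¬ Growing φ) (hpro : Prolongable φ a) (hfix : IsFixedSeq φ a α)
    (hnp : ¬ UltimatelyPeriodic α) (hub : ¬ BFactorsBounded φ α) :
    (fun n => (complexity α n : ℝ)) =Θ[atTop] (fun n => (n : ℝ) ^ 2) := by
  have ha : ¬ BoundedLetter φ a := not_not.2 hpro.2
  obtain ⟨p, hp, hN⟩ := exists_normalForm φ
  have hF := fixedPoint_morphismPow hpro hfix hp
  obtain ⟨u, hu⟩ := hF.start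
  have hg : ∃ g ∈ u, ¬ BoundedLetter φ g := by
    by_contra! hg
    exact hnp (ultimatelyPeriodic_of_bounded hN hF ha hu hg)
  have hub' : ∀ C, ∃ w, IsFactor α w ∧ (∀ b ∈ w, BoundedLetter φ b) ∧ C < w.length := by
    rw [BFactorsBounded] at hub
    push Not at hub
    exact hub
  obtain ⟨C, hC⟩ := complexity_le_of_normalForm hN hF
  obtain ⟨e, m, hm, hlow⟩ := exists_sq_le_complexity hN hF ha hu hg hub'
  constructor
  · refine IsBigO.of_bound (4 * C) ?_
    filter_upwards [eventually_ge_atTop 1] with n hn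
    rw [Real.norm_of_nonneg (by positivity), Real.norm_of_nonneg (by positivity)]
    have h1 : (complexity α n : ℝ) ≤ C * (n + 1) ^ 2 := by exact_mod_cast hC n
    have h2 : (1 : ℝ) ≤ n := by exact_mod_cast hn
    have h3 : ((n : ℝ) + 1) ^ 2 ≤ 4 * n ^ 2 := by nlinarith
    have h4 := mul_le_mul_of_nonneg_left h3 (Nat.cast_nonneg (α := ℝ) C)
    linarith
  · refine IsBigO.of_bound ((16 * m) ^ 2) ?_
    filter_upwards [eventually_ge_atTop (2 * (e + 2)), eventually_ge_atTop (8 * m)] with n hn hn'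
    rw [Real.norm_of_nonneg (by positivity), Real.norm_of_nonneg (by positivity)]
    have hq : n ≤ 16 * m * (n / (8 * m)) := by
      have h1 := Nat.div_add_mod n (8 * m)
      have h2 := Nat.mod_lt n (show 0 < 8 * m by omega)
      have h3 : 8 * m * 1 ≤ 8 * m * (n / (8 * m)) :=
        Nat.mul_le_mul_left _ (Nat.div_pos hn' (by omega))
      nlinarith
    have h1 : n ^ 2 ≤ (16 * m) ^ 2 * complexity α n :=
      calc n ^ 2 ≤ (16 * m * (n / (8 * m))) ^ 2 := Nat.pow_le_pow_left hq 2
        _ = (16 * m) ^ 2 * (n / (8 * m)) ^ 2 := by ring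
        _ ≤ _ := Nat.mul_le_mul_left _ (hlow n hn)
    exact_mod_cast h1
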